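/- The elliptic curve E : y² = x³ + 864·x + 81216 over ℚ has Mordell–Weil rank 1. In particular E(ℚ) is infinite. -/

import Mathlib

/-- The elliptic curve in Weierstrass form `y² = x³ + 864·x + 81216` over `ℚ`. -/
noncomputable def Estmt9 : WeierstrassCurve.Affine ℚ :=
  { a₁ := 0, a₂ := 0, a₃ := 0, a₄ := 864, a₆ := 81216 }


open MeasureTheory in
/-- Minkowski's theorem on linear forms, in dimension three. -/
lemma minkowski_forms (M : Matrix (Fin 3) (Fin 3) ℝ) (hM : M.det ≠ 0) (c : Fin 3 → ℝ)
    (hc : ∀ i, 0 < c i) (h : |M.det| < c 0 * c 1 * c 2) :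
    ∃ k : Fin 3 → ℤ, k ≠ 0 ∧ ∀ i, |(M.mulVec (fun j => (k j : ℝ))) i| < c i := by
  classical
  let B := Pi.basisFun ℝ (Fin 3)
  let s : Set (Fin 3 → ℝ) := (Matrix.toLin' M) ⁻¹' (Set.univ.pi fun i => Set.Ioo (-(c i)) (c i))
  have fund := ZSpan.isAddFundamentalDomain' B (volume : Measure (Fin 3 → ℝ))
  have hdet : LinearMap.det (Matrix.toLin' M) ≠ 0 := by simpa using hM
  have hvol : volume s = ENNReal.ofReal (|M.det|⁻¹ * (8 * (c 0 * c 1 * c 2))) := by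
    rw [Measure.addHaar_preimage_linearMap _ hdet, volume_pi_pi]
    simp only [Real.volume_Ioo, Fin.prod_univ_three]
    rw [← ENNReal.ofReal_mul (by linarith [hc 0]), ← ENNReal.ofReal_mul (by
      have := hc 0; have := hc 1; nlinarith [mul_pos (hc 0) (hc 1)]), ← ENNReal.ofReal_mul (by positivity)]
    congr 1
    rw [LinearMap.det_toLin', abs_inv]
    ring
  have hF : volume (ZSpan.fundamentalDomain B) = 1 := by
    rw [ZSpan.fundamentalDomain_pi_basisFun]
    rw [volume_pi_pi]; simp
  have : Countable (Submodule.span ℤ (Set.range B)).toAddSubgroup :=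
    inferInstanceAs (Countable (Submodule.span ℤ (Set.range B)))
  have := exists_ne_zero_mem_lattice_of_measure_mul_two_pow_lt_measure (s := s) fund ?_ ?_ ?_
  · obtain ⟨x, hx0, hx⟩ := this
    have hxm := x.2
    have hx' : (x : Fin 3 → ℝ) ∈ Submodule.span ℤ (Set.range B) := hxm
    rw [B.mem_span_iff_repr_mem ℤ] at hx'
    choose k hk using hx'
    have hk' : (fun j => (k j : ℝ)) = (x : Fin 3 → ℝ) := by
      ext j
      have := hk j
      simpa [B] using this
    refine ⟨k, ?_, ?_⟩
    · rintro rfl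
      apply hx0
      ext j
      rw [← hk']; simp
    · intro i
      rw [hk']
      have := hx
      simp only [s, Set.mem_preimage, Set.mem_pi, Set.mem_univ, true_imp_iff, Matrix.toLin'_apply,
        Set.mem_Ioo] at this
      exact abs_lt.mpr (this i)
  · intro x hx
    simp only [s, Set.mem_preimage, Set.mem_pi, Set.mem_univ, true_imp_iff, map_neg, Pi.neg_apply,
        Set.mem_Ioo] at hx ⊢
    intro i; constructor <;> linarith [(hx i).1, (hx i).2]
  · exact (convex_pi fun i _ => convex_Ioo _ _).linear_preimage _
  · rw [hvol, hF]
    have h0 : 0 < |M.det| := abs_pos.mpr hM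
    simp only [Module.finrank_fintype_fun_eq_card, Fintype.card_fin, one_mul]
    rw [show (2:ENNReal)^3 = ENNReal.ofReal 8 by norm_num, ENNReal.ofReal_lt_ofReal_iff (by
      have := hc 0; have := hc 1; have := hc 2; positivity)]
    rw [inv_mul_eq_div, lt_div_iff₀ h0]
    linarith

lemma exists_roots : ∃ θ p q : ℝ, θ^3+θ^2+θ+2 = 0 ∧ -1.353210 < θ ∧ θ < -1.353209 ∧
    p = -(1+θ)/2 ∧ 0 < q ∧ q^2 = 1+θ+θ^2-p^2 := by
  obtain ⟨θ, hθ, h0⟩ := intermediate_value_Ioo (a := (-1.353210:ℝ)) (b := -1.353209) (by norm_num)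
    (f := fun x => x^3+x^2+x+2) (by fun_prop) (show (0:ℝ) ∈ _ by constructor <;> norm_num)
  have h1 : 0 < 1+θ+θ^2-(-(1+θ)/2)^2 := by nlinarith [hθ.1, hθ.2]
  exact ⟨θ, _, √(1+θ+θ^2-(-(1+θ)/2)^2), h0, hθ.1, hθ.2, rfl, Real.sqrt_pos.mpr h1,
    Real.sq_sqrt h1.le⟩

open Polynomial in
/-- The key divisibility: there are integers `u v w` with `αγ = β²` at every root of `f`. -/
lemma gamma_exists (a e b t s r k0 k1 k2 : ℤ) (h : b^2 = a^3+a^2*e^2+a*e^4+2*e^6)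
    (hs : s * e^2 + r * b^2 = 1) (ht : t = s * a) :
    ∃ u v w : ℤ, ∀ (S : Type) [CommRing S] (x : S), x^3+x^2+x+2 = 0 →
      ((a:S) - e^2 * x) * (u + v * x + w * x^2) =
        (b * k0 + (x - t) * k1 + (x^2 - t^2) * k2)^2 := by
  let f : ℤ[X] := X^3+X^2+X+2
  have hf : f = X^3+X^2+X+C 2 := rfl
  have hmonic : f.Monic := by rw [hf]; monicity!
  have hdeg : f.natDegree = 3 := by rw [hf]; compute_degree!
  let x : AdjoinRoot f := AdjoinRoot.root f
  have hx : x^3+x^2+x+2 = 0 := by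
    have := AdjoinRoot.eval₂_root f
    simpa [f, eval₂_add] using this
  have hcast : ∀ n : ℤ, AdjoinRoot.of f n = (n : AdjoinRoot f) := fun n => by simp
  have h' : (b:AdjoinRoot f)^2 = a^3+a^2*e^2+a*e^4+2*e^6 := by exact_mod_cast congrArg (Int.cast (R := AdjoinRoot f)) h
  have hs' : (s:AdjoinRoot f) * e^2 + r * b^2 = 1 := by exact_mod_cast congrArg (Int.cast (R := AdjoinRoot f)) hs
  have ht' : (t:AdjoinRoot f) = s * a := by exact_mod_cast congrArg (Int.cast (R := AdjoinRoot f)) ht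
  have d1 : ((a:AdjoinRoot f) - e^2 * x) ∣ (b:AdjoinRoot f)^2 :=
    ⟨a^2 + a*e^2*x + e^4*x^2 + a*e^2 + e^4*x + e^4, by rw [h']; linear_combination e^6 * hx⟩
  have d2 : ((a:AdjoinRoot f) - e^2 * x) ∣ x - t := by
    have : x - t = ((a:AdjoinRoot f) - e^2 * x) * (-s) + b^2 * (r * x) := by
      rw [ht']; linear_combination -x * hs'
    rw [this]
    exact dvd_add (dvd_mul_right _ _) (d1.mul_right _)
  have d3 : ((a:AdjoinRoot f) - e^2 * x) ∣ (b * k0 + (x - t) * k1 + (x^2 - t^2) * k2)^2 := by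
    have : ((b:AdjoinRoot f) * k0 + (x - t) * k1 + (x^2 - t^2) * k2)^2 = b^2 * k0^2 +
      (x - t) * ((k1 + (x+t) * k2) * (2 * b * k0 + (x - t) * (k1 + (x+t)*k2))) := by ring
    rw [this]
    exact dvd_add (d1.mul_right _) (d2.mul_right _)
  obtain ⟨g, hg⟩ := d3
  obtain ⟨G, rfl⟩ := AdjoinRoot.mk_surjective g
  have hG : AdjoinRoot.mk f G = AdjoinRoot.mk f (G %ₘ f) := by
    rw [AdjoinRoot.mk_eq_mk]
    refine ⟨G /ₘ f, ?_⟩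
    have := modByMonic_add_div G f
    linear_combination -this
  have hd : (G %ₘ f).degree ≤ 2 := by
    have h1 := degree_modByMonic_lt G hmonic
    rw [degree_eq_natDegree hmonic.ne_zero, hdeg] at h1
    exact Order.le_of_lt_succ h1
  have hq := eq_quadratic_of_degree_le_two hd
  refine ⟨(G %ₘ f).coeff 0, (G %ₘ f).coeff 1, (G %ₘ f).coeff 2, fun S _ y hy => ?_⟩
  have hl : f.eval₂ (Int.castRingHom S) y = 0 := by simpa [f, eval₂_add] using hy
  have := congrArg (AdjoinRoot.lift (Int.castRingHom S) y hl) hg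
  rw [hG, hq] at this
  simp only [x, map_pow, map_add, map_sub, map_mul, map_intCast, AdjoinRoot.lift_root, AdjoinRoot.mk_X, eq_intCast] at this
  rw [this]; ring

lemma no_root_int (n d : ℤ) (h : n^3+n^2*d+n*d^2+2*d^3 = 0) : (3:ℤ) ∣ n ∧ (3:ℤ) ∣ d := by
  have key : ∀ n d : ZMod 3, n^3+n^2*d+n*d^2+2*d^3 = 0 → n = 0 ∧ d = 0 := by decide
  have h' := congrArg (Int.cast (R := ZMod 3)) h
  push_cast at h'
  have := key _ _ h'
  exact ⟨(ZMod.intCast_zmod_eq_zero_iff_dvd n 3).mp this.1, (ZMod.intCast_zmod_eq_zero_iff_dvd d 3).mp this.2⟩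

lemma no_root_rat (x : ℚ) : x^3+x^2+x+2 ≠ 0 := by
  intro h
  have hd : (x.den : ℚ) ≠ 0 := by exact_mod_cast x.den_nz
  have hx : x = x.num / x.den := (Rat.num_div_den x).symm
  have h2 : (x.num:ℚ)^3+x.num^2*x.den+x.num*x.den^2+2*x.den^3 = 0 := by
    rw [hx] at h
    field_simp at h
    linear_combination h
  have h3 : x.num^3+x.num^2*(x.den:ℤ)+x.num*(x.den:ℤ)^2+2*(x.den:ℤ)^3 = 0 := by exact_mod_cast h2
  obtain ⟨h4, h5⟩ := no_root_int _ _ h3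
  have hc := x.reduced
  have h6 : 3 ∣ x.num.natAbs := Int.natCast_dvd.mp h4
  have h7 : 3 ∣ x.den := by exact_mod_cast h5
  have := Nat.dvd_gcd h6 h7
  rw [hc.gcd_eq_one] at this
  omega

open Polynomial in
lemma lin_indep {θ : ℝ} (hθ : θ^3+θ^2+θ+2 = 0) (r s t : ℚ) (h : (r:ℝ) + s * θ + t * θ^2 = 0) :
    r = 0 ∧ s = 0 ∧ t = 0 := by
  let f : ℚ[X] := X^3+X^2+X+2
  have hf : f = X^3+X^2+X+C 2 := rfl
  have hmonic : f.Monic := by rw [hf]; monicity!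
  have hdeg : f.natDegree = 3 := by rw [hf]; compute_degree!
  have hirr : Irreducible f := by
    rw [irreducible_iff_roots_eq_zero_of_degree_le_three (by omega) (by omega)]
    rw [Multiset.eq_zero_iff_forall_notMem]
    intro x hx
    rw [mem_roots hmonic.ne_zero] at hx
    apply no_root_rat x
    simpa [f] using hx
  have hmin : f = minpoly ℚ θ := minpoly.eq_of_irreducible_of_monic hirr (by simpa [hf] using hθ) hmonic
  have hp : aeval θ (C r + C s * X + C t * X^2 : ℚ[X]) = 0 := by simpa using h
  have hz : (C r + C s * X + C t * X^2 : ℚ[X]) = 0 := by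
    by_contra hne
    have h1 := minpoly.degree_le_of_ne_zero ℚ θ hne hp
    rw [← hmin, degree_eq_natDegree hmonic.ne_zero, hdeg] at h1
    have h2 : (C r + C s * X + C t * X^2 : ℚ[X]).degree ≤ 2 := by compute_degree
    have h3 := h1.trans h2
    revert h3; decide
  have c0 := congrArg (fun P => coeff P 0) hz
  have c1 := congrArg (fun P => coeff P 1) hz
  have c2 := congrArg (fun P => coeff P 2) hz
  simp [coeff_X, coeff_C] at c0 c1 c2
  exact ⟨c0, c1, c2⟩

set_option synthInstance.maxHeartbeats 400000 in
set_option synthInstance.maxSize 1000 in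
lemma enum_box : ∀ w ∈ Finset.Icc (-5:ℤ) 5, ∀ v ∈ Finset.Icc (-3:ℤ) 3, ∀ u ∈ Finset.Icc (-9:ℤ) 9,
    -200 < 100000*u-135321*v+183118*w ∧ 100000*u-135321*v+183118*w < 1600200 ∧
    -228200 < 100000*u+17660*v-141559*w ∧ 100000*u+17660*v-141559*w < 228200 ∧
    -228200 < 120282*v+42485*w ∧ 120282*v+42485*w < 228200 →
    u^3-u^2*v-u^2*w+u*v^2+5*u*v*w-3*u*w^2-2*v^3+2*v^2*w-2*v*w^2+4*w^3 ∈ [1,4,9,16,25,36,49,64,81] →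
    (u,v,w) ∈ [((1:ℤ),(-1:ℤ),(-1:ℤ)),(1,-1,1),(1,-1,2),(1,1,1),(4,-2,4),(4,0,2),(5,-1,3),
      (-1,-1,0),(0,0,1),(1,-2,1),(1,0,0),(1,0,1),(2,-1,0),(2,-1,1),(2,1,0),(3,-1,1),(3,-1,2),
      (4,0,3),(4,0,4),(6,-1,4),(7,-1,4)] := by
  decide +kernel

/-- Local obstruction at 2. -/
lemma obst4 : ∀ g ∈ [((1:ZMod 4),(-1:ZMod 4),(-1:ZMod 4)),(1,-1,1),(1,-1,2),(1,1,1),(4,-2,4),(4,0,2),(5,-1,3)],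
    ∀ a e g0 g1 g2 : ZMod 4,
    a*g.1+2*e^2*g.2.2 = g0^2-4*g1*g2+2*g2^2 →
    a*g.2.1-e^2*g.1+e^2*g.2.2 = 2*g0*g1-2*g1*g2-g2^2 →
    a*g.2.2-e^2*g.2.1+e^2*g.2.2 = g1^2+2*g0*g2-2*g1*g2 → 2 * a = 0 ∧ 2 * e = 0 := by
  decide +kernel

/-- Elements of `ℚ(θ)`, in coordinates. -/
def InK (θ z : ℝ) : Prop := ∃ r s t : ℚ, z = r + s * θ + t * θ^2

lemma InK.mul {θ : ℝ} (hθ : θ^3+θ^2+θ+2 = 0) {x y : ℝ} (hx : InK θ x) (hy : InK θ y) :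
    InK θ (x * y) := by
  obtain ⟨a, b, c, rfl⟩ := hx
  obtain ⟨d, e, f, rfl⟩ := hy
  refine ⟨a*d-2*(b*f+c*e)+2*(c*f), a*e+b*d-(b*f+c*e)-c*f, a*f+b*e+c*d-(b*f+c*e), ?_⟩
  push_cast
  linear_combination (b*f+c*e + c*f*θ - c*f) * hθ

set_option maxHeartbeats 1000000 in
/-- Bounds on the coordinates of `γ`. -/
lemma gamma_bounds {θ p q : ℝ} (hθ : θ^3+θ^2+θ+2 = 0) (h1 : -1.353210 < θ) (h2 : θ < -1.353209)
    (hp : p = -(1+θ)/2) (hq : 0 < q) (hq2 : q^2 = 1+θ+θ^2-p^2) (u v w : ℤ)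
    (hg0 : 0 < (u:ℝ) + v * θ + w * θ^2) (hg1 : (u:ℝ) + v * θ + w * θ^2 < 16)
    (hG : ((u:ℝ) + v * p + w * (p^2-q^2))^2 + (q * (v + 2*p*w))^2 < 2.28^2)
    (hN : u^3-u^2*v-u^2*w+u*v^2+5*u*v*w-3*u*w^2-2*v^3+2*v^2*w-2*v*w^2+4*w^3 ∈
      [1,4,9,16,25,36,49,64,81]) :
    (u,v,w) ∈ [((1:ℤ),(-1:ℤ),(-1:ℤ)),(1,-1,1),(1,-1,2),(1,1,1),(4,-2,4),(4,0,2),(5,-1,3),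
      (-1,-1,0),(0,0,1),(1,-2,1),(1,0,0),(1,0,1),(2,-1,0),(2,-1,1),(2,1,0),(3,-1,1),(3,-1,2),
      (4,0,3),(4,0,4),(6,-1,4),(7,-1,4)] := by
  have hp1 : 0.1766 < p := by rw [hp]; linarith
  have hp1' : 0.1766045 ≤ p := by rw [hp]; linarith
  have hp2' : p ≤ 0.176605 := by rw [hp]; linarith
  have hT1 : θ^2 < 1.831178 := by nlinarith
  have hT2 : 1.831174 < θ^2 := by nlinarith
  have hP1 : p^2 < 0.031190 := by nlinarith
  have hP2 : 0.031189 < p^2 := by nlinarith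
  have hQ1 : q^2 < 1.446780 := by linarith
  have hQ2 : 1.446774 < q^2 := by linarith
  have hq1 : q < 1.202824 := by nlinarith
  have hq3 : 1.202818 < q := by nlinarith
  set R := (u:ℝ) + v * p + w * (p^2-q^2) with hR
  set sg := q * ((v:ℝ) + 2*p*w) with hsg
  have hR1 : |R| < 2.28 := abs_lt_of_sq_lt_sq (by nlinarith [sq_nonneg sg]) (by norm_num)
  have hS1 : |sg| < 2.28 := abs_lt_of_sq_lt_sq (by nlinarith [sq_nonneg R]) (by norm_num)
  rw [abs_lt] at hR1 hS1
  set g := (u:ℝ) + v * θ + w * θ^2 with hg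
  have e1 : (g - R) * q - (θ - p) * sg = w * (q * ((θ-p)^2+q^2)) := by
    rw [hg, hR, hsg]; ring
  have hK : 4.55 < q * ((θ-p)^2+q^2) := by
    have h5 : 1.5298 * 1.5298 ≤ (p - θ) * (p - θ) :=
      mul_self_le_mul_self (by norm_num) (by linarith)
    have h6 : 3.785 < (θ-p)^2+q^2 := by linarith [show (θ-p)^2 = (p-θ)*(p-θ) by ring]
    calc (4.55:ℝ) < 1.202818 * 3.785 := by norm_num
      _ ≤ q * ((θ-p)^2+q^2) := mul_le_mul hq3.le h6.le (by norm_num) hq.le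
  have b1 : |(g - R) * q - (θ - p) * sg| < 25.7 := by
    have h3 : |(g-R)*q| < 18.28 * 1.21 := by
      rw [abs_mul, abs_of_pos hq]
      have : |g-R| < 18.28 := by rw [abs_lt]; constructor <;> linarith
      exact mul_lt_mul'' this (by linarith) (abs_nonneg _) hq.le
    have h4 : |(θ-p)*sg| < 1.53 * 2.28 := by
      rw [abs_mul]
      have h7 : |θ-p| < 1.53 := by rw [abs_lt]; constructor <;> linarith
      have h8 : |sg| < 2.28 := abs_lt.mpr hS1
      exact mul_lt_mul'' h7 h8 (abs_nonneg _) (abs_nonneg _)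
    have := abs_sub ((g-R)*q) ((θ-p)*sg)
    linarith
  rw [e1, abs_mul, abs_of_pos (show 0 < q * ((θ-p)^2+q^2) by linarith)] at b1
  have hw : |(w:ℝ)| < 6 := by
    by_contra hcon
    push Not at hcon
    have := mul_le_mul hcon hK.le (by norm_num) (abs_nonneg _)
    linarith
  have hw' : |w| < 6 := by exact_mod_cast hw
  rw [abs_lt] at hw'
  have hw5 : (-5:ℝ) ≤ w ∧ (w:ℝ) ≤ 5 := ⟨by exact_mod_cast (by omega : -5 ≤ w), by exact_mod_cast (by omega : w ≤ 5)⟩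
  have hv : |(v:ℝ) + 2*p*w| < 1.9 := by
    by_contra hcon
    push Not at hcon
    have : |sg| < 2.28 := abs_lt.mpr hS1
    rw [hsg, abs_mul, abs_of_pos hq] at this
    have := mul_le_mul hq3.le hcon (by norm_num) hq.le
    linarith
  rw [abs_lt] at hv
  have hpw : -0.884 < p * w ∧ p * w < 0.884 := ⟨by
      have := mul_le_mul_of_nonneg_left hw5.1 (show 0 ≤ p by linarith)
      linarith, by
      have := mul_le_mul_of_nonneg_left hw5.2 (show 0 ≤ p by linarith)
      linarith⟩
  have hv4 : -4 < v ∧ v < 4 := ⟨by exact_mod_cast (by linarith : (-4:ℝ) < v), by exact_mod_cast (by linarith : (v:ℝ) < 4)⟩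
  have hv3 : (-3:ℝ) ≤ v ∧ (v:ℝ) ≤ 3 := ⟨by exact_mod_cast (by omega : -3 ≤ v), by exact_mod_cast (by omega : v ≤ 3)⟩
  have aux : ∀ (x k c d B : ℝ), |x| ≤ B → |k - c| ≤ d → 0 ≤ B → |x * k - x * c| ≤ B * d := by
    intro x k c d B hx hk hB
    rw [← mul_sub, abs_mul]
    exact mul_le_mul hx hk (abs_nonneg _) hB
  have aw : |(w:ℝ)| ≤ 5 := abs_le.mpr hw5
  have av : |(v:ℝ)| ≤ 3 := abs_le.mpr hv3
  have a1 := abs_le.mp (aux v θ (-1.35321) 0.00001 3 av (abs_le.mpr ⟨by linarith, by linarith⟩) (by norm_num))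
  have a2 := abs_le.mp (aux w (θ^2) 1.83118 0.00001 5 aw (abs_le.mpr ⟨by linarith, by linarith⟩) (by norm_num))
  have a3 := abs_le.mp (aux v p 0.17660 0.00001 3 av (abs_le.mpr ⟨by linarith, by linarith⟩) (by norm_num))
  have a4 := abs_le.mp (aux w (p^2-q^2) (-1.41559) 0.00001 5 aw (abs_le.mpr ⟨by linarith, by linarith⟩) (by norm_num))
  have a5 := abs_le.mp (aux v q 1.20282 0.00001 3 av (abs_le.mpr ⟨by linarith, by linarith⟩) (by norm_num))
  have hpq1 : 2*p*q < 0.42486 := by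
    have := mul_le_mul hp2' hq1.le hq.le (by norm_num)
    linarith
  have hpq2 : 0.42484 < 2*p*q := by
    have := mul_le_mul hp1' hq3.le (by norm_num) (show 0 ≤ p by linarith)
    linarith
  have a6 := abs_le.mp (aux w (2*p*q) 0.42485 0.00001 5 aw (abs_le.mpr ⟨by linarith, by linarith⟩) (by norm_num))
  have hsg2 : sg = v * q + w * (2*p*q) := by rw [hsg]; ring
  have hu : (-10:ℝ) < u ∧ (u:ℝ) < 10 := ⟨by linarith, by linarith⟩
  have hu' : -10 < u ∧ u < 10 := ⟨by exact_mod_cast hu.1, by exact_mod_cast hu.2⟩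
  refine enum_box w (by rw [Finset.mem_Icc]; omega) v (by rw [Finset.mem_Icc]; omega) u
    (by rw [Finset.mem_Icc]; omega) ⟨?_, ?_, ?_, ?_, ?_, ?_⟩ hN
  · have : (-200:ℝ) < 100000*u-135321*v+183118*w := by linarith
    exact_mod_cast this
  · have : (100000*u-135321*v+183118*w:ℝ) < 1600200 := by linarith
    exact_mod_cast this
  · have : (-228200:ℝ) < 100000*u+17660*v-141559*w := by linarith
    exact_mod_cast this
  · have : (100000*u+17660*v-141559*w:ℝ) < 228200 := by linarith
    exact_mod_cast this
  · have : (-228200:ℝ) < 120282*v+42485*w := by linarith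
    exact_mod_cast this
  · have : (120282*v+42485*w:ℝ) < 228200 := by linarith
    exact_mod_cast this

/-- The norm form of `ℤ[θ]`. -/
def nf (u v w : ℤ) : ℤ :=
  u^3-u^2*v-u^2*w+u*v^2+5*u*v*w-3*u*w^2-2*v^3+2*v^2*w-2*v*w^2+4*w^3

lemma nf_eq {θ p q : ℝ} (hθ : θ^3+θ^2+θ+2 = 0)
    (hp : p = -(1+θ)/2) (hq2 : q^2 = 1+θ+θ^2-p^2) (u v w : ℤ) :
    (nf u v w : ℝ) = ((u:ℝ) + v * θ + w * θ^2) *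
      (((u:ℝ) + v * p + w * (p^2-q^2))^2 + (q * (v + 2*p*w))^2) := by
  have e : (((u:ℝ) + v * p + w * (p^2-q^2))^2 + (q * (v + 2*p*w))^2) =
      u^2 + u * v * (2*p) + u * w * (2*(p^2-q^2)) + v^2*(p^2+q^2) + v*w*(2*p*(p^2+q^2))
        + w^2*(p^2+q^2)^2 := by ring
  rw [e]
  have h1 : p^2+q^2 = 1+θ+θ^2 := by linarith
  have h2 : p^2-q^2 = (1+θ)^2/2 - (1+θ+θ^2) := by rw [hq2, hp]; ring
  rw [h1, h2, hp]
  unfold nf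
  push_cast
  grind

set_option maxHeartbeats 2000000 in
lemma exists_gamma {θ p q : ℝ} (hθ : θ^3+θ^2+θ+2 = 0) (h1 : -1.353210 < θ) (h2 : θ < -1.353209)
    (hp : p = -(1+θ)/2) (hq : 0 < q) (hq2 : q^2 = 1+θ+θ^2-p^2)
    (a e b : ℤ) (he : e ≠ 0) (hb : b ≠ 0) (hc : IsCoprime a e)
    (h : b^2 = a^3+a^2*e^2+a*e^4+2*e^6) :
    ∃ u v w g0 g1 g2 : ℤ, ((a:ℝ) - e^2*θ) * (u + v * θ + w * θ^2) = (g0 + g1 * θ + g2 * θ^2)^2 ∧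
    (u,v,w) ∈ [((1:ℤ),(-1:ℤ),(-1:ℤ)),(1,-1,1),(1,-1,2),(1,1,1),(4,-2,4),(4,0,2),(5,-1,3),
      (-1,-1,0),(0,0,1),(1,-2,1),(1,0,0),(1,0,1),(2,-1,0),(2,-1,1),(2,1,0),(3,-1,1),(3,-1,2),
      (4,0,3),(4,0,4),(6,-1,4),(7,-1,4)] := by
  have hcop : IsCoprime (e^2) (b^2) := by
    have h3 : IsCoprime (e^2) (a^3) := (hc.symm.pow)
    have h4 : b^2 = a^3 + e^2 * (a^2+a*e^2+2*e^4) := by rw [h]; ring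
    rw [h4]
    exact IsCoprime.add_mul_left_right h3 _
  obtain ⟨s, r, hsr⟩ := hcop
  set t := s * a with ht
  set α : ℝ := (a:ℝ) - e^2*θ with hα
  set A : ℝ := ((a:ℝ)-e^2*p)^2 + (e^2*q)^2 with hA
  have heR : (e:ℝ) ≠ 0 := by exact_mod_cast he
  have hbR : (b:ℝ) ≠ 0 := by exact_mod_cast hb
  have hA0 : 0 < A := by rw [hA]; positivity
  have hR : (b:ℝ)^2 = a^3+a^2*e^2+a*e^4+2*e^6 := by exact_mod_cast h
  have hαA : α * A = b^2 := by
    have : A = a^2 - 2*a*e^2*p + e^4*(p^2+q^2) := by rw [hA]; ring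
    rw [this, hα, hR, hq2, hp]
    linear_combination (-(e:ℝ)^6) * hθ
  have hα0 : 0 < α := by
    have : 0 < α * A := by rw [hαA]; positivity
    exact (pos_iff_pos_of_mul_pos this).mpr hA0
  -- the three linear forms
  let M : Matrix (Fin 3) (Fin 3) ℝ :=
    !![(b:ℝ), θ - t, θ^2-t^2; b, p - t, p^2-q^2-t^2; 0, q, 2*p*q]
  have hdet : M.det = b * (q * ((θ-p)^2+q^2)) := by
    simp only [M, Matrix.det_fin_three]
    simp
    ring
  have hq0 : 0 < q * ((θ-p)^2+q^2) := by positivity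
  have hdisc : (q * ((θ-p)^2+q^2))^2 = 83/4 := by
    have : (q * ((θ-p)^2+q^2))^2 = q^2 * ((θ-p)^2+q^2)^2 := by ring
    rw [this, hq2, hp]
    grind
  have hq4 : q * ((θ-p)^2+q^2) < 4.56 := by
    apply lt_of_pow_lt_pow_left₀ 2 (by norm_num)
    rw [hdisc]; norm_num
  set x := √α with hx
  set y := √A with hy
  have hx0 : 0 < x := Real.sqrt_pos.mpr hα0
  have hy0 : 0 < y := Real.sqrt_pos.mpr hA0
  have hx2 : x^2 = α := Real.sq_sqrt hα0.le
  have hy2 : y^2 = A := Real.sq_sqrt hA0.le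
  have hxy : x * y = |(b:ℝ)| := by
    rw [hx, hy, ← Real.sqrt_mul hα0.le, hαA, Real.sqrt_sq_eq_abs]
  set c := √(1.14 * y) with hcdef
  have hc0 : 0 < c := Real.sqrt_pos.mpr (by positivity)
  have hc2 : c^2 = 1.14 * y := Real.sq_sqrt (by positivity)
  obtain ⟨k, hk, hkb⟩ := minkowski_forms M (by rw [hdet]; positivity) ![4*x, c, c]
    (by intro i; fin_cases i <;> simp <;> positivity)
    (by
      rw [hdet, abs_mul, abs_of_pos hq0]
      have : (![4*x, c, c] : Fin 3 → ℝ) 0 * (![4*x, c, c] : Fin 3 → ℝ) 1 * (![4*x, c, c] : Fin 3 → ℝ) 2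
        = |(b:ℝ)| * 4.56 := by
        rw [← hxy]; simp; linear_combination (4*x) * hc2
      rw [this]
      exact mul_lt_mul_of_pos_left hq4 (abs_pos.mpr hbR))
  obtain ⟨u, v, w, huvw⟩ := gamma_exists a e b t s r (k 0) (k 1) (k 2) h hsr ht
  set g0 : ℤ := b * k 0 - t * k 1 - t^2 * k 2 with hg0
  set L1 : ℝ := g0 + k 1 * θ + k 2 * θ^2 with hL1
  set L2 : ℝ := g0 + k 1 * p + k 2 * (p^2-q^2) with hL2
  set L3 : ℝ := q * (k 1 + 2*p*k 2) with hL3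
  have B1 : |L1| < 4 * x := by
    have := hkb 0
    simp [M, Matrix.mulVec, dotProduct, Fin.sum_univ_three] at this
    convert this using 2
    rw [hL1, hg0]; push_cast; ring
  have B2 : |L2| < c := by
    have := hkb 1
    simp [M, Matrix.mulVec, dotProduct, Fin.sum_univ_three] at this
    convert this using 2
    rw [hL2, hg0]; push_cast; ring
  have B3 : |L3| < c := by
    have := hkb 2
    simp [M, Matrix.mulVec, dotProduct, Fin.sum_univ_three] at this
    convert this using 2
    rw [hL3]; ring
  have S1 : L1^2 < 16 * α := by
    have := sq_lt_sq' (abs_lt.mp B1).1 (abs_lt.mp B1).2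
    rw [mul_pow, hx2] at this; linarith
  have S2 : L2^2 < 1.14 * y := by
    have := sq_lt_sq' (abs_lt.mp B2).1 (abs_lt.mp B2).2
    rwa [hc2] at this
  have S3 : L3^2 < 1.14 * y := by
    have := sq_lt_sq' (abs_lt.mp B3).1 (abs_lt.mp B3).2
    rwa [hc2] at this
  have hL1ne : L1 ≠ 0 := by
    intro h0
    obtain ⟨r0, r1, r2⟩ := lin_indep hθ (g0:ℚ) (k 1) (k 2) (by push_cast; exact h0)
    have r1' : k 1 = 0 := by exact_mod_cast r1
    have r2' : k 2 = 0 := by exact_mod_cast r2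
    have r0' : g0 = 0 := by exact_mod_cast r0
    rw [hg0, r1', r2'] at r0'
    have r0'' : k 0 = 0 := by simpa [hb] using r0'
    apply hk
    funext i
    fin_cases i <;> simp [r0'', r1', r2']
  set γ : ℝ := u + v * θ + w * θ^2 with hγ
  set G : ℝ := ((u:ℝ) + v * p + w * (p^2-q^2))^2 + (q * (v + 2*p*w))^2 with hG
  have E1 : α * γ = L1^2 := by
    have := huvw ℝ θ hθ
    rw [hα, hγ, this, hL1, hg0]
    push_cast; ring
  have hω : (⟨p, q⟩ : ℂ)^3 + ⟨p, q⟩^2 + ⟨p, q⟩ + 2 = 0 := by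
    have i1 : p^3-3*p*q^2+p^2-q^2+p+2 = 0 := by
      rw [hq2, hp]; grind
    have i2 : q*(3*p^2-q^2+2*p+1) = 0 := by
      rw [hq2, hp]; grind
    apply Complex.ext
    · simp [pow_succ]; linear_combination i1
    · simp [pow_succ]; linear_combination i2
  have E2 : A * G = (L2^2 + L3^2)^2 := by
    have h9 := congrArg Complex.normSq (huvw ℂ ⟨p, q⟩ hω)
    rw [map_mul, map_pow] at h9
    have n1 : Complex.normSq ((a:ℂ) - (e:ℂ)^2 * ⟨p, q⟩) = A := by
      rw [hA, Complex.normSq_apply]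
      simp [pow_two]
    have n2 : Complex.normSq ((u:ℂ) + (v:ℂ) * ⟨p, q⟩ + (w:ℂ) * ⟨p, q⟩^2) = G := by
      rw [hG, Complex.normSq_apply]
      simp [pow_two]; ring
    have n3 : Complex.normSq ((b:ℂ) * (k 0 : ℂ) + (⟨p, q⟩ - (t:ℂ)) * (k 1 : ℂ) +
        (⟨p, q⟩^2 - (t:ℂ)^2) * (k 2 : ℂ)) = L2^2 + L3^2 := by
      rw [hL2, hL3, hg0, Complex.normSq_apply]
      simp [pow_two]; ring
    rw [n1, n2, n3] at h9
    exact h9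
  have hγ0 : 0 < γ := by
    have : 0 < α * γ := by rw [E1]; positivity
    exact (pos_iff_pos_of_mul_pos this).mp hα0
  have hγ1 : γ < 16 := by
    have : α * γ < α * 16 := by rw [E1]; linarith
    exact lt_of_mul_lt_mul_left this hα0.le
  have hG2 : G < 2.28^2 := by
    have i1 : L2^2+L3^2 < 2.28 * y := by linarith
    have : A * G < A * 2.28^2 := by
      rw [E2, ← hy2]
      have := pow_lt_pow_left₀ i1 (by positivity) (n := 2) (by norm_num)
      linarith [this, mul_pow (2.28:ℝ) y 2]
    exact lt_of_mul_lt_mul_left this hA0.le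
  have hN := nf_eq hθ hp hq2 u v w
  rw [← hγ, ← hG] at hN
  have hN' := nf_eq hθ hp hq2 g0 (k 1) (k 2)
  rw [← hL1, ← hL2, ← hL3] at hN'
  have hNN : nf u v w * b^2 = (nf g0 (k 1) (k 2))^2 := by
    have : (nf u v w : ℝ) * b^2 = (nf g0 (k 1) (k 2) : ℝ)^2 := by
      rw [hN, hN', ← hαA, mul_pow, ← E1, ← E2]; ring
    exact_mod_cast this
  have hdvd : b ∣ nf g0 (k 1) (k 2) := by
    rw [← Int.pow_dvd_pow_iff (n := 2) (by norm_num)]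
    exact ⟨nf u v w, by rw [← hNN]; ring⟩
  obtain ⟨m, hm⟩ := hdvd
  have hNm : nf u v w = m^2 := by
    rw [hm] at hNN
    have : b^2 * (nf u v w) = b^2 * m^2 := by linear_combination hNN
    exact mul_left_cancel₀ (pow_ne_zero 2 hb) this
  have hGpos : 0 ≤ G := by positivity
  have hGne : G ≠ 0 := by
    intro h0
    have hz : nf u v w = 0 := by
      have : (nf u v w : ℝ) = 0 := by rw [hN, h0, mul_zero]
      exact_mod_cast this
    have hz2 : nf g0 (k 1) (k 2) = 0 := by
      rw [hz, zero_mul] at hNN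
      exact pow_eq_zero_iff (two_ne_zero) |>.mp hNN.symm
    rw [hz2] at hN'
    have h00 : L2^2+L3^2 = 0 := by
      have : L1 * (L2^2+L3^2) = 0 := by rw [← hN']; simp
      exact (mul_eq_zero.mp this).resolve_left hL1ne
    have l3 : L3 = 0 := pow_eq_zero_iff two_ne_zero |>.mp
      (le_antisymm (by linarith [sq_nonneg L2]) (sq_nonneg L3))
    have l2 : L2 = 0 := pow_eq_zero_iff two_ne_zero |>.mp
      (le_antisymm (by linarith [sq_nonneg L3]) (sq_nonneg L2))
    have l3' : (k 1 : ℝ) + 2 * p * k 2 = 0 := by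
      rw [hL3] at l3
      exact (mul_eq_zero.mp l3).resolve_left hq.ne'
    rw [hp] at l3'
    obtain ⟨r0, r1, r2⟩ := lin_indep hθ ((k 1 : ℚ) - k 2) (-k 2) 0 (by
      push_cast; linear_combination l3')
    have r1' : (k 2 : ℚ) = 0 := by linarith
    have r0' : (k 1 : ℚ) = 0 := by linarith
    have r1'' : k 2 = 0 := by exact_mod_cast r1'
    have r0'' : k 1 = 0 := by exact_mod_cast r0'
    rw [hL2, r1'', r0''] at l2
    apply hL1ne
    rw [hL1, r1'', r0'']
    simpa using l2
  have hNpos : 0 < nf u v w := by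
    have : 0 < (nf u v w : ℝ) := by rw [hN]; positivity
    exact_mod_cast this
  have hNlt : nf u v w < 84 := by
    have : (nf u v w : ℝ) < 84 := by
      rw [hN]
      calc γ * G ≤ 16 * 2.28^2 := mul_le_mul hγ1.le hG2.le hGpos (by norm_num)
        _ < 84 := by norm_num
    exact_mod_cast this
  have hmem : nf u v w ∈ [1,4,9,16,25,36,49,64,81] := by
    rw [hNm] at hNpos hNlt ⊢
    rw [← sq_abs] at hNpos hNlt ⊢
    have m1 : |m| < 10 := by nlinarith [abs_nonneg m]
    have m0 : 0 < |m| := by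
      rcases (abs_nonneg m).eq_or_lt with h0 | h0
      · rw [← h0] at hNpos; simp at hNpos
      · exact h0
    interval_cases |m| <;> simp
  refine ⟨u, v, w, g0, k 1, k 2, E1, ?_⟩
  exact gamma_bounds hθ h1 h2 hp hq hq2 u v w hγ0 hγ1 hG2 hmem

lemma obstructed {θ : ℝ} (hθ : θ^3+θ^2+θ+2 = 0) (a e u v w g0 g1 g2 : ℤ) (hc : IsCoprime a e)
    (h : ((a:ℝ) - e^2*θ) * (u + v * θ + w * θ^2) = (g0 + g1 * θ + g2 * θ^2)^2)
    (hm : ((u : ZMod 4), (v : ZMod 4), (w : ZMod 4)) ∈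
      [((1:ZMod 4),(-1:ZMod 4),(-1:ZMod 4)),(1,-1,1),(1,-1,2),(1,1,1),(4,-2,4),(4,0,2),(5,-1,3)]) :
    False := by
  obtain ⟨c0, c1, c2⟩ := lin_indep hθ
    ((a*u+2*e^2*w - (g0^2-4*g1*g2+2*g2^2) : ℤ) : ℚ)
    ((a*v-e^2*u+e^2*w - (2*g0*g1-2*g1*g2-g2^2) : ℤ) : ℚ)
    ((a*w-e^2*v+e^2*w - (g1^2+2*g0*g2-2*g1*g2) : ℤ) : ℚ) (by
      push_cast
      linear_combination h + (e^2 * w + 2*g1*g2 + g2^2*(θ - 1)) * hθ)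
  have d0 : a*u+2*e^2*w - (g0^2-4*g1*g2+2*g2^2) = 0 := by exact_mod_cast c0
  have d1 : a*v-e^2*u+e^2*w - (2*g0*g1-2*g1*g2-g2^2) = 0 := by exact_mod_cast c1
  have d2 : a*w-e^2*v+e^2*w - (g1^2+2*g0*g2-2*g1*g2) = 0 := by exact_mod_cast c2
  have f0 := congrArg (Int.cast (R := ZMod 4)) d0
  have f1 := congrArg (Int.cast (R := ZMod 4)) d1
  have f2 := congrArg (Int.cast (R := ZMod 4)) d2
  push_cast at f0 f1 f2
  obtain ⟨z1, z2⟩ := obst4 _ hm (a : ZMod 4) e g0 g1 g2 (sub_eq_zero.mp f0) (sub_eq_zero.mp f1)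
    (sub_eq_zero.mp f2)
  have y1 : (4:ℤ) ∣ 2 * a := (ZMod.intCast_zmod_eq_zero_iff_dvd (2*a) 4).mp (by push_cast; exact z1)
  have y2 : (4:ℤ) ∣ 2 * e := (ZMod.intCast_zmod_eq_zero_iff_dvd (2*e) 4).mp (by push_cast; exact z2)
  have w1 : (2:ℤ) ∣ a := by omega
  have w2 : (2:ℤ) ∣ e := by omega
  have := hc.isUnit_of_dvd' w1 w2
  rw [Int.isUnit_iff] at this
  omega

lemma descent_int {θ p q : ℝ} (hθ : θ^3+θ^2+θ+2 = 0) (h1 : -1.353210 < θ) (h2 : θ < -1.353209)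
    (hp : p = -(1+θ)/2) (hq : 0 < q) (hq2 : q^2 = 1+θ+θ^2-p^2)
    (a e b : ℤ) (he : e ≠ 0) (hb : b ≠ 0) (hc : IsCoprime a e)
    (h : b^2 = a^3+a^2*e^2+a*e^4+2*e^6) :
    ∃ z, InK θ z ∧ ((a:ℝ) - e^2*θ = z^2 ∨ ((a:ℝ) - e^2*θ) * (-1-θ) = z^2) := by
  obtain ⟨u, v, w, g0, g1, g2, hE, hm⟩ := exists_gamma hθ h1 h2 hp hq hq2 a e b he hb hc h
  have hob := obstructed hθ a e u v w g0 g1 g2 hc hE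
  have fS : ∀ r s t : ℚ, ((u:ℝ) + v * θ + w * θ^2) * (r + s * θ + t * θ^2)^2 = 1 →
      ∃ z, InK θ z ∧ ((a:ℝ) - e^2*θ = z^2 ∨ ((a:ℝ) - e^2*θ) * (-1-θ) = z^2) := by
    intro r s t hr
    refine ⟨(g0 + g1 * θ + g2 * θ^2) * (r + s * θ + t * θ^2),
      InK.mul hθ ⟨g0, g1, g2, by push_cast; rfl⟩ ⟨r, s, t, rfl⟩, Or.inl ?_⟩
    rw [mul_pow, ← hE, mul_assoc, hr, mul_one]
  have fE : ∀ r s t : ℚ, ((u:ℝ) + v * θ + w * θ^2) * (r + s * θ + t * θ^2)^2 = -1-θ →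
      ∃ z, InK θ z ∧ ((a:ℝ) - e^2*θ = z^2 ∨ ((a:ℝ) - e^2*θ) * (-1-θ) = z^2) := by
    intro r s t hr
    refine ⟨(g0 + g1 * θ + g2 * θ^2) * (r + s * θ + t * θ^2),
      InK.mul hθ ⟨g0, g1, g2, by push_cast; rfl⟩ ⟨r, s, t, rfl⟩, Or.inr ?_⟩
    rw [mul_pow, ← hE, mul_assoc, hr]
  clear hE h
  simp only [List.mem_cons, List.not_mem_nil, or_false, Prod.mk.injEq] at hm
  rcases hm with hm | hm | hm | hm | hm | hm | hm | hm | hm | hm | hm | hm | hm | hm | hm | hm | hm |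
    hm | hm | hm | hm <;> obtain ⟨rfl, rfl, rfl⟩ := hm
  · exact (hob (by push_cast; decide)).elim
  · exact (hob (by push_cast; decide)).elim
  · exact (hob (by push_cast; decide)).elim
  · exact (hob (by push_cast; decide)).elim
  · exact (hob (by push_cast; decide)).elim
  · exact (hob (by push_cast; decide)).elim
  · exact (hob (by push_cast; decide)).elim
  · exact fE (1/(1)) (0/(1)) (0/(1)) (by push_cast; grind)
  · exact fS (1/(2)) (1/(2)) (1/(2)) (by push_cast; grind)
  · exact fS (3/(-5)) (2/(-5)) (1/(-5)) (by push_cast; grind)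
  · exact fS (1/(-1)) (0/(-1)) (0/(-1)) (by push_cast; grind)
  · exact fE (-1/(-1)) (-1/(-1)) (0/(-1)) (by push_cast; grind)
  · exact fS (-1/(-4)) (-1/(-4)) (1/(-4)) (by push_cast; grind)
  · exact fE (1/(2)) (-1/(2)) (-1/(2)) (by push_cast; grind)
  · exact fE (1/(-2)) (1/(-2)) (1/(-2)) (by push_cast; grind)
  · exact fE (0/(-4)) (2/(-4)) (2/(-4)) (by push_cast; grind)
  · exact fS (-1/(-1)) (-1/(-1)) (0/(-1)) (by push_cast; grind)
  · exact fE (3/(-4)) (3/(-4)) (1/(-4)) (by push_cast; grind)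
  · exact fE (-4/(-8)) (-4/(-8)) (0/(-8)) (by push_cast; grind)
  · exact fS (1/(-2)) (-1/(-2)) (-1/(-2)) (by push_cast; grind)
  · exact fE (-1/(-5)) (-4/(-5)) (-2/(-5)) (by push_cast; grind)

lemma descent {θ p q : ℝ} (hθ : θ^3+θ^2+θ+2 = 0) (h1 : -1.353210 < θ) (h2 : θ < -1.353209)
    (hp : p = -(1+θ)/2) (hq : 0 < q) (hq2 : q^2 = 1+θ+θ^2-p^2)
    (X Y : ℚ) (h : Y^2 = X^3+X^2+X+2) :
    ∃ z, InK θ z ∧ ((X:ℝ) - θ = z^2 ∨ ((X:ℝ) - θ) * (-1-θ) = z^2) := by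
  set n : ℤ := X.num with hn
  set d : ℤ := (X.den : ℤ) with hd
  have hdpos : 0 < d := by rw [hd]; exact_mod_cast X.den_pos
  have hdQ : (d:ℚ) ≠ 0 := by exact_mod_cast hdpos.ne'
  have hX : X = n / d := (Rat.num_div_den X).symm
  have hco : IsCoprime n d := by
    rw [Int.isCoprime_iff_gcd_eq_one]; exact X.reduced
  set F : ℤ := n^3+n^2*d+n*d^2+2*d^3 with hF
  have hsq : (Y * d^2)^2 = ((d * F : ℤ) : ℚ) := by
    rw [mul_pow, h, hX, hF]; push_cast; field_simp
  have hYint : ∃ c : ℤ, Y * d^2 = c := by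
    have : IsSquare ((d * F : ℤ) : ℚ) := ⟨Y * d^2, by rw [← hsq]; ring⟩
    rw [Rat.isSquare_intCast_iff] at this
    obtain ⟨c, hc⟩ := this
    have h3 : (Y * d^2)^2 = (c:ℚ)^2 := by rw [hsq, hc]; push_cast; ring
    rcases sq_eq_sq_iff_eq_or_eq_neg.mp h3 with h4 | h4
    · exact ⟨c, h4⟩
    · exact ⟨-c, by rw [h4]; push_cast; rfl⟩
  obtain ⟨c, hc⟩ := hYint
  have hdF : d * F = c^2 := by
    rw [hc] at hsq; exact_mod_cast hsq.symm
  have hcop : IsCoprime d F := by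
    have h3 : IsCoprime d (n^3) := hco.symm.pow_right
    have h4 : F = n^3 + d * (n^2+n*d+2*d^2) := by rw [hF]; ring
    rw [h4]
    exact IsCoprime.add_mul_left_right h3 _
  have hFpos : 0 ≤ F := by
    by_contra hneg
    push Not at hneg
    nlinarith [sq_nonneg c]
  obtain ⟨e, he⟩ := Int.sq_of_isCoprime hcop hdF
  have he' : d = e^2 := by
    rcases he with he | he
    · exact he
    · nlinarith [sq_nonneg e]
  obtain ⟨b, hb⟩ := Int.sq_of_isCoprime hcop.symm (by rw [mul_comm]; exact hdF)
  have hb' : F = b^2 := by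
    rcases hb with hb | hb
    · exact hb
    · nlinarith [sq_nonneg b]
  have he0 : e ≠ 0 := by rintro rfl; simp at he'; omega
  have hb0 : b ≠ 0 := by
    rintro rfl
    have : F = 0 := by simpa using hb'
    obtain ⟨i1, i2⟩ := no_root_int n d (by rw [← hF]; exact this)
    have := hco.isUnit_of_dvd' i1 i2
    rw [Int.isUnit_iff] at this
    omega
  have hne : IsCoprime n e := by
    rw [he'] at hco
    exact (IsCoprime.pow_right_iff (by norm_num)).mp hco
  obtain ⟨z, hz, hzz⟩ := descent_int hθ h1 h2 hp hq hq2 n e b he0 hb0 hne (by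
    rw [← hb', hF, he']; ring)
  have heR : (e:ℝ) ≠ 0 := by exact_mod_cast he0
  have hXR : (X:ℝ) = n / e^2 := by
    have : X = n / e^2 := by rw [hX, he']; push_cast; rfl
    rw [this]; push_cast; rfl
  refine ⟨z * ((1/e : ℚ) : ℝ), InK.mul hθ hz ⟨1/e, 0, 0, by push_cast; ring⟩, ?_⟩
  rw [hXR]
  rcases hzz with hzz | hzz
  · left
    rw [mul_pow, ← hzz]; push_cast; field_simp
  · right
    rw [mul_pow, ← hzz]; push_cast; field_simp

open WeierstrassCurve.Affine in
lemma E_eqn {x y : ℚ} (h : Estmt9.Nonsingular x y) : y^2 = x^3+864*x+81216 := by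
  have := (equation_iff (W := Estmt9) x y).mp h.1
  simp [Estmt9] at this
  exact this

lemma E_y_ne {x y : ℚ} (h : y^2 = x^3+864*x+81216) : y ≠ 0 := by
  rintro rfl
  apply no_root_rat ((x-12)/36)
  linear_combination (-1/46656) * h

open WeierstrassCurve.Affine in
lemma E_ns {x y : ℚ} (h : y^2 = x^3+864*x+81216) : Estmt9.Nonsingular x y := by
  rw [nonsingular_iff, equation_iff]
  have := E_y_ne h
  refine ⟨by simp [Estmt9]; exact h, Or.inr ?_⟩
  simp [Estmt9]
  intro h2
  apply this; linarith

open WeierstrassCurve.Affine in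
lemma E_neg {x y : ℚ} (h : Estmt9.Nonsingular x y) (h' : Estmt9.Nonsingular x (-y)) :
    -(Point.some x y h) = Point.some x (-y) h' := by
  rw [Point.neg_some]
  simp [negY, Estmt9]

open WeierstrassCurve.Affine in
lemma E_add {x₁ y₁ x₂ y₂ : ℚ} (h₁ : Estmt9.Nonsingular x₁ y₁) (h₂ : Estmt9.Nonsingular x₂ y₂)
    (hx : x₁ ≠ x₂) : ∃ l x y h, l * (x₁ - x₂) = y₁ - y₂ ∧ x = l^2 - x₁ - x₂ ∧
      y = -(l * (x - x₁) + y₁) ∧ Point.some x₁ y₁ h₁ + Point.some x₂ y₂ h₂ = Point.some x y h := by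
  refine ⟨Estmt9.slope x₁ x₂ y₁ y₂, _, _, _, ?_, ?_, ?_, Point.add_of_X_ne hx⟩
  · rw [slope_of_X_ne hx, div_mul_cancel₀ _ (sub_ne_zero.mpr hx)]
  · simp [addX, Estmt9]
  · simp [addY, negAddY, negY, Estmt9]

open WeierstrassCurve.Affine in
lemma E_dbl {x₁ y₁ : ℚ} (h₁ : Estmt9.Nonsingular x₁ y₁) :
    ∃ l x y h, l * (2 * y₁) = 3*x₁^2+864 ∧ x = l^2 - 2 * x₁ ∧
      y = -(l * (x - x₁) + y₁) ∧ Point.some x₁ y₁ h₁ + Point.some x₁ y₁ h₁ = Point.some x y h := by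
  have hy0 := E_y_ne (E_eqn h₁)
  have hy : y₁ ≠ Estmt9.negY x₁ y₁ := by
    simp [negY, Estmt9]; intro h; apply hy0; linarith
  refine ⟨Estmt9.slope x₁ x₁ y₁ y₁, _, _, _, ?_, ?_, ?_, Point.add_self_of_Y_ne hy⟩
  · rw [slope_of_Y_ne rfl hy]
    simp [negY, Estmt9]
    field_simp
    ring
  · simp [addX, Estmt9]; ring
  · simp [addY, negAddY, negY, Estmt9]

/-- Algebra of halving. -/
lemma halve_alg {θ : ℝ} (hθ : θ^3+θ^2+θ+2 = 0) (X Y : ℚ) (h : Y^2 = X^3+X^2+X+2) (z : ℝ)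
    (hz : InK θ z) (hX : (X:ℝ) - θ = z^2) :
    ∃ x y m : ℚ, y^2 = x^3+x^2+x+2 ∧ 2 * y * m = 3*x^2+2*x+1 ∧ X = m^2 - 1 - 2*x ∧
      Y = m * (X - x) + y := by
  obtain ⟨r, s, t, rfl⟩ := hz
  obtain ⟨c0, c1, c2⟩ := lin_indep hθ
    (X - (r^2-4*s*t+2*t^2)) (-1 - (2*r*s-2*s*t-t^2)) (-(s^2+2*r*t-2*s*t)) (by
      push_cast
      linear_combination hX + (2*s*t+t^2*(θ-1)) * hθ)
  have ht : t ≠ 0 := by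
    rintro rfl
    have : s^2 = 0 := by linear_combination -c2
    have : s = 0 := by simpa using this
    rw [this] at c1
    norm_num at c1
  obtain ⟨v, hv⟩ : ∃ v, s + v * t - t = 0 := ⟨(t-s)/t, by field_simp; ring⟩
  set m := r + v * s - t with hm
  set n := v * r - 2 * t with hn
  have hlin : (θ + v) * ((r:ℝ) + s * θ + t * θ^2) = m * θ + n := by
    have hv' : (s:ℝ) + v * t - t = 0 := by exact_mod_cast hv
    rw [hm, hn]; push_cast
    linear_combination (t:ℝ) * hθ + θ^2 * hv'
  have hcub : (θ+v)^2 * (X - θ) = (m * θ + n)^2 := by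
    rw [hX, ← hlin]; ring
  obtain ⟨d0, d1, d2⟩ := lin_indep hθ
    (v^2*X - n^2 + 2) (2*v*X - v^2 - 2*m*n + 1) (X - 2*v - m^2 + 1) (by
      push_cast
      linear_combination hcub + hθ)
  have key : ∀ T : ℚ, T^3+T^2+T+2 = (m*T+n)^2 + (T-X)*(T+v)^2 := by
    intro T
    linear_combination d0 + T * d1 + T^2 * d2
  have k1 := key X
  rw [sub_self, zero_mul, add_zero, ← h] at k1
  have base : (-m*v+n)^2 = (-v)^3+(-v)^2+(-v)+2 := by
    have := key (-v)
    linear_combination -this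
  rcases sq_eq_sq_iff_eq_or_eq_neg.mp k1 with h1 | h1
  · refine ⟨-v, -m*v+n, m, base, ?_, by linear_combination d2, by rw [h1]; ring⟩
    linear_combination -d1 + 2*v*d2
  · refine ⟨-v, -(-m*v+n), -m, by linear_combination base, ?_, by linear_combination d2, by rw [h1]; ring⟩
    linear_combination -d1 + 2*v*d2

open WeierstrassCurve.Affine in
lemma E_halve {θ : ℝ} (hθ : θ^3+θ^2+θ+2 = 0) {x y : ℚ} (h : Estmt9.Nonsingular x y) (z : ℝ)
    (hz : InK θ z) (hX : (x:ℝ) - (36*θ+12) = z^2) :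
    ∃ R : Estmt9.Point, Point.some x y h = R + R := by
  obtain ⟨x', y', m, k1, k2, k3, k4⟩ := halve_alg hθ ((x-12)/36) (-(y/216))
    (by linear_combination (1/46656) * E_eqn h) (z * ((1/6:ℚ):ℝ))
    (InK.mul hθ hz ⟨1/6, 0, 0, by simp⟩) (by push_cast; linear_combination (1/36) * hX)
  have hns : Estmt9.Nonsingular (36*x'+12) (216*y') := E_ns (by linear_combination 46656 * k1)
  refine ⟨Point.some _ _ hns, ?_⟩
  obtain ⟨l, x2, y2, h2, e1, e2, e3, e4⟩ := E_dbl hns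
  have hy' : y' ≠ 0 := by
    intro h0
    apply E_y_ne (E_eqn hns)
    rw [h0]; ring
  have hl : l = 6 * m := by
    apply mul_right_cancel₀ (mul_ne_zero (by norm_num : (432:ℚ) ≠ 0) hy')
    linear_combination e1 - 1296 * k2
  rw [e4, Point.some.injEq]
  have hx : x = x2 := by rw [e2, hl]; linear_combination 36 * k3
  refine ⟨hx, ?_⟩
  rw [e3, hl, ← hx]
  linear_combination (-216) * k4

/-- The point `(-24, 216)`. -/
noncomputable def EP : Estmt9.Point :=
  WeierstrassCurve.Affine.Point.some (-24) 216 (E_ns (by norm_num))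

open WeierstrassCurve.Affine in
lemma E_weak (Q : Estmt9.Point) : ∃ R : Estmt9.Point, Q = R + R ∨ EP + Q = R + R := by
  obtain ⟨θ, p, q, hθ, h1, h2, hp, hq, hq2⟩ := exists_roots
  rcases Q with _ | ⟨x, y, h⟩
  · exact ⟨0, Or.inl (by rw [add_zero]; rfl)⟩
  have hE := E_eqn h
  obtain ⟨z, hz, hzz⟩ := descent hθ h1 h2 hp hq hq2 ((x-12)/36) (y/216)
    (by linear_combination (1/46656) * hE)
  rcases hzz with hzz | hzz
  · obtain ⟨R, hR⟩ := E_halve hθ h (z * ((6:ℚ):ℝ)) (InK.mul hθ hz ⟨6, 0, 0, by simp⟩)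
      (by push_cast at hzz ⊢; linear_combination 36 * hzz)
    exact ⟨R, Or.inl hR⟩
  · by_cases hx : (-24:ℚ) = x
    · subst hx
      have hy : y^2 = 216^2 := by rw [hE]; norm_num
      rcases sq_eq_sq_iff_eq_or_eq_neg.mp hy with hy | hy
      · subst hy
        exact ⟨EP, Or.inr rfl⟩
      · subst hy
        refine ⟨0, Or.inr ?_⟩
        rw [add_zero, EP, ← E_neg (E_ns (by norm_num)) h, add_neg_cancel]
    · obtain ⟨l, x3, y3, h3, e1, e2, e3, e4⟩ := E_add (E_ns (by norm_num) : Estmt9.Nonsingular (-24) 216) h hx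
      have hy0 := E_y_ne hE
      have hyR : (y:ℝ) ≠ 0 := by exact_mod_cast hy0
      -- inverses of `x - Θ` and `-24 - Θ`
      set Θ : ℝ := 36*θ+12 with hΘ
      have hΘ3 : Θ^3+864*Θ+81216 = 0 := by rw [hΘ]; linear_combination 46656 * hθ
      have ER : (y:ℝ)^2 = x^3+864*x+81216 := by exact_mod_cast hE
      have i1 : ((x:ℝ) - Θ) * (x^2+x*Θ+Θ^2+864) = y^2 := by linear_combination -ER - hΘ3
      have i2 : ((-24:ℝ) - Θ) * (576-24*Θ+Θ^2+864) = 216^2 := by linear_combination -hΘ3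
      have n1 : (x:ℝ) - Θ ≠ 0 := by
        intro h0; rw [h0, zero_mul] at i1; exact hyR (by simpa using i1.symm)
      have n2 : (-24:ℝ) - Θ ≠ 0 := by
        intro h0; rw [h0, zero_mul] at i2; norm_num at i2
      have hzz' : ((x:ℝ) - Θ) * (-24 - Θ) = (36 * z)^2 := by
        rw [hΘ]; push_cast at hzz; linear_combination 1296 * hzz
      have e1R : (l:ℝ) * (-24 - x) = 216 - y := by exact_mod_cast e1
      have e2R : (x3:ℝ) = l^2 + 24 - x := by rw [e2]; push_cast; ring
      have prod : ((x:ℝ) - Θ) * (-24 - Θ) * (x3 - Θ) = (l * (Θ + 24) + 216)^2 := by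
        have hk : (-24 - (x:ℝ)) ≠ 0 := by
          intro h0; apply hx
          have : ((-24:ℚ):ℝ) = (x:ℝ) := by push_cast; linarith
          exact_mod_cast this
        have hll : (l:ℝ)^2 * (-24 - x) = -(1440 - 24*x + x^2) + 432 * l := by
          apply mul_right_cancel₀ hk
          linear_combination (216 - y + l * (-24 - x) - 432) * e1R + ER
        rw [e2R]
        linear_combination (Θ + 24) * hll - hΘ3
      refine (E_halve hθ h3 (((l:ℝ) * (Θ + 24) + 216) * (36 * z) *
        ((x^2+x*Θ+Θ^2+864) * (576-24*Θ+Θ^2+864)) * ((1/(y^2*216^2):ℚ):ℝ)) ?_ ?_).imp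
          fun R hR => Or.inr (by rw [← hR, ← e4]; rfl)
      · refine InK.mul hθ (InK.mul hθ (InK.mul hθ ?_ (InK.mul hθ ⟨36, 0, 0, by simp⟩ hz))
          (InK.mul hθ ?_ ?_)) ⟨1/(y^2*216^2), 0, 0, by simp⟩
        · exact ⟨l*36+216, 36 * l, 0, by rw [hΘ]; push_cast; ring⟩
        · exact ⟨x^2+12*x+144+864, 36*x+864, 1296, by rw [hΘ]; push_cast; ring⟩
        · exact ⟨576-288+144+864, -864+864, 1296, by rw [hΘ]; push_cast; ring⟩
      · have hsq : (36 * z)^2 ≠ 0 := by rw [← hzz']; exact mul_ne_zero n1 n2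
        have f1 : ((x:ℝ)^2+x*Θ+Θ^2+864) ≠ 0 := by
          intro h0; rw [h0, mul_zero] at i1; exact hyR (by simpa using i1.symm)
        have f2 : (576-24*Θ+Θ^2+864) ≠ 0 := by
          intro h0; rw [h0, mul_zero] at i2; norm_num at i2
        push_cast
        rw [← hΘ]
        clear_value Θ
        rw [mul_pow, mul_pow, mul_pow, ← prod, ← hzz']
        have i3 : ((x:ℝ) - Θ) * (-24 - Θ) * ((x^2+x*Θ+Θ^2+864) * (576-24*Θ+Θ^2+864)) = y^2*216^2 := by
          rw [← i1, ← i2]; ring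
        rw [← i3]
        generalize (x:ℝ)^2+x*Θ+Θ^2+864 = A at *
        generalize 576-24*Θ+Θ^2+864 = B at *
        field_simp

lemma quartic_no_root (x : ℚ) : x^4+4*x^3+2*x^2-12*x+1 ≠ 0 := by
  intro h
  have hd : (x.den : ℚ) ≠ 0 := by exact_mod_cast x.den_nz
  have hx : x = x.num / x.den := (Rat.num_div_den x).symm
  have h2 : (x.num:ℚ)^4+4*x.num^3*x.den+2*x.num^2*x.den^2-12*x.num*x.den^3+x.den^4 = 0 := by
    rw [hx] at h
    field_simp at h
    linear_combination h
  have h3 : x.num^4+4*x.num^3*(x.den:ℤ)+2*x.num^2*(x.den:ℤ)^2-12*x.num*(x.den:ℤ)^3+(x.den:ℤ)^4 = 0 := by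
    exact_mod_cast h2
  have key : ∀ n d : ZMod 5, n^4+4*n^3*d+2*n^2*d^2-12*n*d^3+d^4 = 0 → n = 0 ∧ d = 0 := by decide
  have h3' := congrArg (Int.cast (R := ZMod 5)) h3
  push_cast at h3'
  obtain ⟨k1, k2⟩ := key _ _ h3'
  have h4 : (5:ℤ) ∣ x.num := (ZMod.intCast_zmod_eq_zero_iff_dvd _ 5).mp k1
  have h7 : 5 ∣ x.den := (ZMod.natCast_eq_zero_iff _ 5).mp k2
  have h6 : 5 ∣ x.num.natAbs := Int.natCast_dvd.mp h4
  have := Nat.dvd_gcd h6 h7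
  rw [x.reduced.gcd_eq_one] at this
  omega

open WeierstrassCurve.Affine in
lemma EP_not_dbl (R : Estmt9.Point) : EP ≠ R + R := by
  intro hR
  rcases R with _ | ⟨x, y, h⟩
  · have : EP = 0 := by rw [hR]; exact add_zero 0
    exact Point.some_ne_zero _ this
  · obtain ⟨l, x2, y2, h2, e1, e2, e3, e4⟩ := E_dbl h
    rw [e4, EP, Point.some.injEq] at hR
    have hE := E_eqn h
    obtain ⟨hx, hy⟩ := hR
    rw [← hx] at e2
    apply quartic_no_root ((x-12)/36)
    have : (3*x^2+864)^2 = 4*(x^3+864*x+81216)*(2*x-24) := by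
      rw [← e1, ← hE]
      linear_combination -4*y^2 * e2
    linear_combination (1/1679616) * this

open WeierstrassCurve.Affine in
lemma E_no_two_torsion (R : Estmt9.Point) (h0 : R + R = 0) : R = 0 := by
  rcases R with _ | ⟨x, y, h⟩
  · rfl
  · obtain ⟨l, x2, y2, h2, e1, e2, e3, e4⟩ := E_dbl h
    rw [e4] at h0
    exact (Point.some_ne_zero _ h0).elim

lemma EP_inf : ¬ IsOfFinAddOrder EP := by
  intro h
  have hpos := h.addOrderOf_pos
  have hn := addOrderOf_nsmul_eq_zero EP
  rcases Nat.even_or_odd (addOrderOf EP) with ⟨k, hk⟩ | ⟨k, hk⟩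
  · rw [hk, add_nsmul] at hn
    have := E_no_two_torsion _ hn
    have := addOrderOf_le_of_nsmul_eq_zero (by omega) this
    omega
  · apply EP_not_dbl (-(k • EP))
    rw [hk, add_nsmul, one_nsmul, two_mul, add_nsmul] at hn
    have : EP = -(k • EP + k • EP) := eq_neg_of_add_eq_zero_right hn
    rw [← neg_add]
    exact this

instance E_elliptic : WeierstrassCurve.IsElliptic Estmt9 := by
  refine ⟨?_⟩
  rw [isUnit_iff_ne_zero]
  simp only [WeierstrassCurve.Δ, WeierstrassCurve.b₂, WeierstrassCurve.b₄, WeierstrassCurve.b₆,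
    WeierstrassCurve.b₈, Estmt9]
  norm_num

open WeierstrassCurve in
lemma E_addSub_eval (s t u : ℚ) :
    (fun i => (addSubMap Estmt9 i).eval ![s, t, u]) =
      ![s^2 - 1728*s*u - 324864*t*u + 746496*u^2, 2*t*s + 1728*t*u + 324864*u^2, t^2-4*s*u] := by
  funext i
  fin_cases i <;>
    simp [addSubMap, WeierstrassCurve.b₂, WeierstrassCurve.b₄, WeierstrassCurve.b₆,
    WeierstrassCurve.b₈, Estmt9] <;> ring

open WeierstrassCurve WeierstrassCurve.Affine in
lemma E_addSub (P Q : Estmt9.Point) : ∃ c : ℚ, c ≠ 0 ∧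
    (fun i => (addSubMap Estmt9 i).eval (P.sym2x Q)) = c • (P + Q).sym2x (P - Q) := by
  rcases P with _ | ⟨x, y, h⟩
  · rw [← Point.zero_def]
    refine ⟨1, one_ne_zero, ?_⟩
    rw [zero_add, zero_sub, Point.sym2x_neg_right]
    rcases Q with _ | ⟨x', y', h'⟩
    · rw [← Point.zero_def, Point.sym2x_zero_zero, E_addSub_eval]
      simp
    · rw [Point.sym2x_zero_some, Point.sym2x_some_some, E_addSub_eval]
      simp; constructor <;> ring
  rcases Q with _ | ⟨x', y', h'⟩
  · rw [← Point.zero_def]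
    refine ⟨1, one_ne_zero, ?_⟩
    rw [add_zero, sub_zero, Point.sym2x_some_zero, Point.sym2x_some_some, E_addSub_eval]
    simp; constructor <;> ring
  have hE := E_eqn h
  have hE' := E_eqn h'
  have hy0 := E_y_ne hE
  rw [Point.sym2x_some_some, E_addSub_eval]
  have hself : ∀ l X : ℚ, l * (2 * y) = 3 * x^2+864 → X = l^2 - 2*x →
      ![(x*x)^2 - 1728*(x*x)*1 - 324864*(x+x)*1 + 746496*1^2, 2*(x+x)*(x*x) + 1728*(x+x)*1 + 324864*1^2,
        (x+x)^2-4*(x*x)*1] = (4*y^2) • ![X, 1, 0] := by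
    intro l X h1 h2
    simp only [Matrix.smul_cons, smul_eq_mul, Matrix.smul_empty]
    have e : 4*y^2*X = (3*x^2+864)^2 - 8*x*y^2 := by rw [h2, ← h1]; ring
    rw [e, hE]
    congr 1
    · ring
    · congr 1
      · ring
      · congr 1
        ring
  by_cases hx : x = x'
  · subst hx
    refine ⟨4*y^2, by positivity, ?_⟩
    obtain ⟨l, X, Y, hns, e1, e2, e3, e4⟩ := E_dbl h
    rcases sq_eq_sq_iff_eq_or_eq_neg.mp (hE'.trans hE.symm) with hy | hy
    · subst hy
      rw [sub_self, e4, Point.sym2x_some_zero]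
      exact hself l X e1 e2
    · subst hy
      rw [← E_neg h h', add_neg_cancel, sub_neg_eq_add, e4, Point.sym2x_zero_some]
      exact hself l X e1 e2
  · have hxx : x - x' ≠ 0 := sub_ne_zero.mpr hx
    refine ⟨(x-x')^2, by positivity, ?_⟩
    have h'' : Estmt9.Nonsingular x' (-y') := E_ns (by rw [neg_sq]; exact hE')
    obtain ⟨l, X, Y, hns, e1, e2, e3, e4⟩ := E_add h h' hx
    obtain ⟨l', X', Y', hns', e1', e2', e3', e4'⟩ := E_add h h'' hx
    rw [sub_eq_add_neg (Point.some x y h), E_neg h' h'', e4, e4', Point.sym2x_some_some]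
    simp only [Matrix.smul_cons, smul_eq_mul, Matrix.smul_empty]
    have k1 : (x-x')^2 * X = (y-y')^2 - (x-x')^2*(x+x') := by rw [e2, ← e1]; ring
    have k2 : (x-x')^2 * X' = (y+y')^2 - (x-x')^2*(x+x') := by
      have : y + y' = y - -y' := by ring
      rw [this, e2', ← e1']; ring
    congr 1
    · apply mul_left_cancel₀ (pow_ne_zero 2 hxx)
      have : (x-x')^2 * ((x-x')^2 * (X * X')) = ((x-x')^2 * X) * ((x-x')^2 * X') := by ring
      rw [this, k1, k2]
      have : ((y - y') ^ 2 - (x - x') ^ 2 * (x + x')) * ((y + y') ^ 2 - (x - x') ^ 2 * (x + x')) =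
        (y^2-y'^2)^2 - 2*(y^2+y'^2)*((x - x') ^ 2 * (x + x')) + ((x - x') ^ 2 * (x + x'))^2 := by ring
      rw [this, hE, hE']; ring
    · congr 1
      · linear_combination -k1 - k2 - 2 * hE - 2 * hE'
      · congr 1
        ring

open WeierstrassCurve WeierstrassCurve.Affine Height in
lemma E_parallelogram : ∃ C : ℝ, ∀ P Q : Estmt9.Point,
    |logHeight (P+Q).xRep + logHeight (P-Q).xRep - 2 * (logHeight P.xRep + logHeight Q.xRep)| ≤ C := by
  obtain ⟨C₁, h₁⟩ := abs_logHeight_addSubMap_sub_two_mul_logHeight_le Estmt9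
  obtain ⟨C₂, h₂⟩ := abs_logHeight_sym2_sub_le ℚ
  have h₂' : ∀ P Q : Estmt9.Point,
      |logHeight (P.sym2x Q) - (logHeight P.xRep + logHeight Q.xRep)| ≤ C₂ := by
    intro P Q
    have eta : ∀ v : Fin 2 → ℚ, ![v 0, v 1] = v := by
      intro v; funext i; fin_cases i <;> rfl
    have hP := eta P.xRep
    have hQ := eta Q.xRep
    have := h₂ (a := P.xRep 0) (b := P.xRep 1) (c := Q.xRep 0) (d := Q.xRep 1)
      (by rw [hP]; exact P.xRep_ne_zero) (by rw [hQ]; exact Q.xRep_ne_zero)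
    rw [hP, hQ] at this
    exact this
  refine ⟨C₁ + 3 * C₂, fun P Q => ?_⟩
  obtain ⟨c, hc, hcc⟩ := E_addSub P Q
  have a1 := h₁ (P.sym2x Q)
  rw [hcc, logHeight_smul_eq_logHeight _ hc] at a1
  have a2 := h₂' P Q
  have a3 := h₂' (P+Q) (P-Q)
  rw [abs_le] at a1 a2 a3 ⊢
  constructor <;> linarith [a1.1, a1.2, a2.1, a2.2, a3.1, a3.2]

open WeierstrassCurve WeierstrassCurve.Affine Height in
lemma E_northcott : Northcott (fun P : Estmt9.Point => logHeight P.xRep) := by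
  refine ⟨fun B => ?_⟩
  have hfin : {x : ℚ | logHeight₁ x ≤ B}.Finite := Northcott.finite_le B
  have hfin2 : (insert ![1, 0] ((fun x : ℚ => ![x, 1]) '' {x : ℚ | logHeight₁ x ≤ B})).Finite :=
    (hfin.image _).insert _
  refine Set.Finite.subset (Set.Finite.preimage' (f := fun P : Estmt9.Point => P.xRep) hfin2 ?_) ?_
  · intro v _
    by_cases hv : ∃ P : Estmt9.Point, P.xRep = v
    · obtain ⟨P, rfl⟩ := hv
      refine Set.Finite.subset (Set.toFinite {P, -P}) ?_
      intro Q hQ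
      have hQ' : Q.xRep = P.xRep := hQ
      rcases Point.xRep_eq_xRep_iff.mp hQ' with h | h <;> simp [h]
    · convert Set.finite_empty
      ext Q
      simp only [Set.mem_preimage, Set.mem_singleton_iff, Set.mem_empty_iff_false, iff_false]
      exact fun h => hv ⟨Q, h⟩
  · intro P hP
    rcases P with _ | ⟨x, y, h⟩
    · left; rfl
    · right
      refine ⟨x, ?_, rfl⟩
      have hP' : logHeight (Point.some x y h).xRep ≤ B := hP
      rw [Point.xRep_some] at hP'
      show logHeight₁ x ≤ B
      rw [logHeight₁_eq_logHeight]; exact hP'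

open WeierstrassCurve WeierstrassCurve.Affine Height in
lemma E_fg : AddGroup.FG Estmt9.Point := by
  obtain ⟨C, hC⟩ := E_parallelogram
  have := E_northcott
  refine AddCommGroup.fg_of_descent' (h := fun P : Estmt9.Point => logHeight P.xRep) (C := C) ?_ ?_ hC
  · have hmem : ∀ R : Estmt9.Point, R + R ∈ (nsmulAddMonoidHom (α := Estmt9.Point) 2).range :=
      fun R => ⟨R, by simp [two_nsmul]⟩
    have : Finite (Estmt9.Point ⧸ (nsmulAddMonoidHom (α := Estmt9.Point) 2).range) := by
      refine Set.finite_univ_iff.mp (Set.Finite.subset (Set.toFinite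
        {((0 : Estmt9.Point) : Estmt9.Point ⧸ (nsmulAddMonoidHom (α := Estmt9.Point) 2).range),
         ((-EP : Estmt9.Point) : Estmt9.Point ⧸ (nsmulAddMonoidHom (α := Estmt9.Point) 2).range)}) ?_)
      intro q _
      induction q using QuotientAddGroup.induction_on with
      | H Q =>
        obtain ⟨R, hR | hR⟩ := E_weak Q
        · left
          rw [QuotientAddGroup.eq, add_zero, hR]
          exact neg_mem (hmem R)
        · right
          rw [Set.mem_singleton_iff, QuotientAddGroup.eq]
          have : -Q + -EP = -(R + R) := by rw [← hR]; abel
          rw [this]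
          exact neg_mem (hmem R)
    exact AddSubgroup.finiteIndex_of_finite_quotient
  · intro P
    exact logHeight_nonneg _

/-- A finitely generated abelian group in which every element is of the form `2R` or `2R - p`
with `p` of infinite order has rank one. -/
lemma rank_one_of {G : Type} [AddCommGroup G] (hfg : AddGroup.FG G) (p : G)
    (hp : ¬ IsOfFinAddOrder p) (hw : ∀ Q : G, ∃ R : G, Q = R + R ∨ p + Q = R + R) :
    ∃ P : G, ¬ IsOfFinAddOrder P ∧ ∀ Q : G, ∃ (n : ℤ) (T : G), IsOfFinAddOrder T ∧ Q = n • P + T := by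
  have hfin : Module.Finite ℤ G := Module.Finite.iff_addGroup_fg.mpr hfg
  let S := Submodule.torsion ℤ G
  have hS : ∀ x : G, x ∈ S ↔ IsOfFinAddOrder x := by
    intro x
    rw [isOfFinAddOrder_iff_zsmul_eq_zero]
    constructor
    · rintro ⟨⟨a, ha⟩, hx⟩
      exact ⟨a, nonZeroDivisors.ne_zero ha, hx⟩
    · rintro ⟨a, ha, hx⟩
      exact ⟨⟨a, mem_nonZeroDivisors_of_ne_zero ha⟩, hx⟩
  let M := G ⧸ S
  let b := Module.finBasis ℤ M
  let φ : M → (Fin (Module.finrank ℤ M) → ZMod 2) := fun m i => ((b.repr m i : ℤ) : ZMod 2)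
  have hφ : Function.Surjective φ := by
    intro f
    refine ⟨b.equivFun.symm (fun i => ((f i).val : ℤ)), ?_⟩
    funext i
    have : b.repr (b.equivFun.symm (fun i => ((f i).val : ℤ))) i = ((f i).val : ℤ) := by
      rw [← b.equivFun_apply, LinearEquiv.apply_symm_apply]
    simp only [φ, this]
    simp
  have hdbl : ∀ m : M, φ (m + m) = 0 := by
    intro m; funext i
    simp only [φ, map_add, Finsupp.add_apply, Pi.zero_apply, Int.cast_add]
    exact CharTwo.add_self_eq_zero _
  have hsub : ∀ m : M, φ m = 0 ∨ φ m = φ (S.mkQ p) := by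
    intro m
    obtain ⟨Q, rfl⟩ := S.mkQ_surjective m
    obtain ⟨R, hR | hR⟩ := hw Q
    · left; rw [hR, map_add]; exact hdbl _
    · right
      have h1 := hdbl (S.mkQ R)
      rw [← map_add, ← hR, map_add] at h1
      funext i
      have h2 := congrFun h1 i
      simp only [φ, map_add, Finsupp.add_apply, Pi.zero_apply, Int.cast_add] at h2 ⊢
      exact (CharTwo.add_eq_zero.mp h2).symm
  have hcard : Fintype.card (Fin (Module.finrank ℤ M) → ZMod 2) ≤ 2 := by
    have : (Finset.univ : Finset (Fin (Module.finrank ℤ M) → ZMod 2)) ⊆ {0, φ (S.mkQ p)} := by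
      intro f _
      obtain ⟨m, rfl⟩ := hφ f
      simpa using hsub m
    calc _ = (Finset.univ : Finset (Fin (Module.finrank ℤ M) → ZMod 2)).card := rfl
      _ ≤ _ := Finset.card_le_card this
      _ ≤ 2 := Finset.card_le_two
  have hr : Module.finrank ℤ M ≤ 1 := by
    rw [Fintype.card_fun, ZMod.card, Fintype.card_fin] at hcard
    by_contra hcon
    push Not at hcon
    have := Nat.pow_le_pow_right (n := 2) (by norm_num) hcon
    norm_num at this
    omega
  have hp0 : S.mkQ p ≠ 0 := by
    rw [Ne, Submodule.mkQ_apply, Submodule.Quotient.mk_eq_zero, hS]; exact hp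
  have hr1 : Module.finrank ℤ M = 1 := by
    have : Nontrivial M := ⟨⟨_, _, hp0⟩⟩
    have : 0 < Module.finrank ℤ M := Module.finrank_pos
    omega
  obtain ⟨g, hg0, hg⟩ := finrank_eq_one_iff' (K := ℤ) (V := M) |>.mp hr1
  obtain ⟨P, rfl⟩ := S.mkQ_surjective g
  refine ⟨P, ?_, fun Q => ?_⟩
  · rw [← hS, ← Submodule.Quotient.mk_eq_zero]; exact hg0
  · obtain ⟨c, hc⟩ := hg (S.mkQ Q)
    refine ⟨c, Q - c • P, ?_, by abel⟩
    rw [← hS, ← Submodule.Quotient.mk_eq_zero, ← Submodule.mkQ_apply, map_sub, map_smul, hc, sub_self]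

/-- The elliptic curve `E : y² = x³ + 864x + 81216` over `ℚ` has Mordell–Weil rank 1:
there is a point `P ∈ E(ℚ)` of infinite order such that every rational point is an
integer multiple of `P` plus a torsion point. In particular `E(ℚ)` is infinite. -/
theorem stmt_9 :
    (∃ P : Estmt9.Point, ¬ IsOfFinAddOrder P ∧
      ∀ Q : Estmt9.Point, ∃ (n : ℤ) (T : Estmt9.Point),
        IsOfFinAddOrder T ∧ Q = n • P + T) ∧
    Infinite Estmt9.Point := by
  refine ⟨rank_one_of E_fg EP EP_inf E_weak, ?_⟩
  by_contra hfin
  rw [not_infinite_iff_finite] at hfin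
  exact EP_inf (isOfFinAddOrder_of_finite EP)
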